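/- arXiv:2102.13640 — 6 statements merged into one kernel-verified Lean document; each statement's English description precedes it below -/
import Mathlib

section
/- Let X = ∏_{i=1}^d [a_i, b_i] ⊂ ℝ^d with a_i < b_i for all i, and let H be a nonempty subset of the space C(X, ℝ) of continuous real-valued functions on X, compact with respect to the supremum norm and upwards directed, and let f̂ ∈ H. Define the pointwise worst-case upper bound ub(x) := sup_{f ∈ H} f(x). Then for every strictly increasing continuous function u : ℝ → ℝ, the function ub belongs to H and is the unique maximizer over h ∈ H of the functional h ↦ ∫_X u(h(x) − f̂(x)) dx (Lebesgue measure). -/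
open MeasureTheory

instance ContinuousMap.instClosedIciTopology {α β : Type*} [TopologicalSpace α]
    [TopologicalSpace β] [PartialOrder β] [ClosedIciTopology β] : ClosedIciTopology C(α, β) where
  isClosed_Ici f := by
    have heq : Set.Ici f = ⋂ x, (fun g : C(α, β) => g x) ⁻¹' Set.Ici (f x) := by
      ext g
      simp [ContinuousMap.le_def]
    rw [heq]
    exact isClosed_iInter fun x => isClosed_Ici.preimage (continuous_eval_const x)

/-- A nonempty compact directed set has a greatest element when upper sets are closed. -/
theorem IsCompact.exists_isGreatest_of_directedOn {α : Type*} [Preorder α] [TopologicalSpace α]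
    [ClosedIciTopology α] {s : Set α} (hs : IsCompact s) (hne : s.Nonempty)
    (hdir : DirectedOn (· ≤ ·) s) : ∃ m, IsGreatest s m := by
  have hfin : ∀ t : Finset s, (s ∩ ⋂ f ∈ t, Set.Ici (f : α)).Nonempty := by
    intro t
    have := hne.to_subtype
    obtain ⟨g, hg⟩ := hdir.directed_val.finset_le t
    exact ⟨g, g.2, Set.mem_iInter₂.2 hg⟩
  obtain ⟨m, hm, hub⟩ :=
    hs.inter_iInter_nonempty (fun f : s => Set.Ici (f : α)) (fun _ => isClosed_Ici) hfin
  exact ⟨m, hm, fun f hf => Set.mem_iInter.1 hub ⟨f, hf⟩⟩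

/-- The restriction of a measure that is positive on open sets to a subset of the closure of its
interior is positive on relatively open sets. -/
theorem MeasureTheory.Measure.isOpenPosMeasure_comap_subtype_val {α : Type*} [TopologicalSpace α]
    [MeasurableSpace α] (ν : Measure α) [ν.IsOpenPosMeasure] {s : Set α} (hs : MeasurableSet s)
    (hsub : s ⊆ closure (interior s)) :
    (ν.comap (Subtype.val : s → α)).IsOpenPosMeasure where
  open_pos U hU hne := by
    obtain ⟨V, hV, rfl⟩ := isOpen_induced_iff.1 hU
    obtain ⟨x, hx⟩ := hne
    have hpos : 0 < ν (V ∩ interior s) :=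
      (hV.inter isOpen_interior).measure_pos ν (mem_closure_iff.1 (hsub x.2) V hV hx)
    rw [comap_subtype_coe_apply hs, Subtype.image_preimage_coe, Set.inter_comm]
    exact (hpos.trans_le (measure_mono (Set.inter_subset_inter_right V interior_subset))).ne'

theorem Set.Icc_subset_closure_interior_of_forall_lt {ι : Type*} [Finite ι] {a b : ι → ℝ}
    (hab : ∀ i, a i < b i) : Set.Icc a b ⊆ closure (interior (Set.Icc a b)) := by
  rw [← Set.pi_univ_Icc, interior_pi_set Set.finite_univ, closure_pi_set]
  simp [interior_Icc, closure_Ioo (hab _).ne]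

/-- Theorem 1 (Single optimization problem): for `X = ∏ i [a i, b i]` with `a i < b i`,
`H` a nonempty compact (sup-norm) upwards directed subset of `C(X, ℝ)` and `f̂ ∈ H`,
the pointwise supremum `ub` belongs to `H` and is the unique maximizer of
`h ↦ ∫_X u (h x - f̂ x) dx` for every strictly increasing continuous `u : ℝ → ℝ`. -/
theorem stmt0 (d : ℕ) (a b : Fin d → ℝ) (hab : ∀ i, a i < b i)
    (H : Set C(Set.Icc a b, ℝ)) (hne : H.Nonempty) (hcomp : IsCompact H)
    (hdir : ∀ f₁ ∈ H, ∀ f₂ ∈ H, ∃ f ∈ H, ∀ x, max (f₁ x) (f₂ x) ≤ f x)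
    (fhat : C(Set.Icc a b, ℝ)) (hfhat : fhat ∈ H)
    (u : ℝ → ℝ) (hu : StrictMono u) (hucont : Continuous u)
    (μ : Measure (Set.Icc a b))
    (hμ : μ = MeasureTheory.volume.comap
      (Subtype.val : Set.Icc a b → (Fin d → ℝ))) :
    ∃ ub ∈ H,
      (∀ x, ub x = ⨆ f : H, (f : C(Set.Icc a b, ℝ)) x) ∧
      (∀ h ∈ H, ∫ x, u (h x - fhat x) ∂μ ≤ ∫ x, u (ub x - fhat x) ∂μ) ∧
      (∀ h ∈ H, (∫ x, u (h x - fhat x) ∂μ) = (∫ x, u (ub x - fhat x) ∂μ) → h = ub) := by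
  subst hμ
  have hX : MeasurableSet (Set.Icc a b) := measurableSet_Icc
  have := Measure.isOpenPosMeasure_comap_subtype_val volume hX
    (Set.Icc_subset_closure_interior_of_forall_lt hab)
  set μ := volume.comap (Subtype.val : Set.Icc a b → (Fin d → ℝ))
  have : IsFiniteMeasure μ := by
    refine ⟨?_⟩
    rw [comap_subtype_coe_apply hX, Set.image_univ, Subtype.range_coe]
    exact isCompact_Icc.measure_lt_top
  have hdir' : DirectedOn (· ≤ ·) H := by
    intro f₁ h₁ f₂ h₂
    obtain ⟨f, hf, hle⟩ := hdir f₁ h₁ f₂ h₂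
    exact ⟨f, hf, fun x => (le_max_left _ _).trans (hle x),
      fun x => (le_max_right _ _).trans (hle x)⟩
  obtain ⟨ub, hub, hle⟩ := hcomp.exists_isGreatest_of_directedOn hne hdir'
  have hcont (h : C(Set.Icc a b, ℝ)) : Continuous fun x => u (h x - fhat x) :=
    hucont.comp (h.continuous.sub fhat.continuous)
  have hint (h : C(Set.Icc a b, ℝ)) : Integrable (fun x => u (h x - fhat x)) μ :=
    (hcont h).integrable_of_hasCompactSupport (HasCompactSupport.of_compactSpace _)
  have hmono : ∀ h ∈ H, ∀ x, u (h x - fhat x) ≤ u (ub x - fhat x) := fun h hh x =>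
    hu.monotone (sub_le_sub_right (hle hh x) _)
  refine ⟨ub, hub, fun x => ?_, fun h hh => integral_mono (hint h) (hint ub) (hmono h hh),
    fun h hh heq => ?_⟩
  · have hgr : IsGreatest (Set.range fun f : H => (f : C(Set.Icc a b, ℝ)) x) (ub x) :=
      ⟨⟨⟨ub, hub⟩, rfl⟩, Set.forall_mem_range.2 fun f => hle f.2 x⟩
    exact hgr.csSup_eq.symm
  · have hae := (integral_eq_iff_of_ae_le (hint h) (hint ub) (ae_of_all _ (hmono h hh))).1 heq
    ext x
    exact sub_left_injective
      (hu.injective (congrFun (((hcont h).ae_eq_iff_eq μ (hcont ub)).1 hae) x))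
end

section
/- Let X be a nonempty topological space equipped with a finite Borel measure μ with full support, and let H be a nonempty subset of the bounded continuous real-valued functions on X, compact with respect to the supremum norm and upwards directed. Then the pointwise supremum function ub(x) := sup_{f ∈ H} f(x) is itself an element of H; in particular, ub is a bounded continuous function on X. -/
open MeasureTheory

/-- A nonempty compact upwards directed set of bounded continuous functions has a greatest
element. -/
theorem BoundedContinuousFunction.exists_isGreatest_of_isCompact {X : Type*} [TopologicalSpace X]
    {H : Set (BoundedContinuousFunction X ℝ)} (hne : H.Nonempty) (hcomp : IsCompact H)
    (hdir : ∀ f₁ ∈ H, ∀ f₂ ∈ H, ∃ f ∈ H, ∀ x, max (f₁ x) (f₂ x) ≤ f x) :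
    ∃ g ∈ H, ∀ f ∈ H, ∀ x, f x ≤ g x := by
  have hclosed : ∀ f : BoundedContinuousFunction X ℝ,
      IsClosed {g : BoundedContinuousFunction X ℝ | ∀ x, f x ≤ g x} := fun f => by
    simp only [Set.ofPred_forall]
    exact isClosed_iInter fun x =>
      isClosed_le continuous_const (continuous_eval_const x)
  have : Nonempty H := hne.to_subtype
  obtain ⟨g, hg⟩ := IsCompact.nonempty_iInter_of_directed_nonempty_isCompact_isClosed
    (fun f : H => H ∩ {g | ∀ x, f.1 x ≤ g x})
    (fun f₁ f₂ => by
      obtain ⟨f, hf, h⟩ := hdir f₁ f₁.2 f₂ f₂.2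
      exact ⟨⟨f, hf⟩,
        fun g hg => ⟨hg.1, fun x => (le_max_left _ _).trans ((h x).trans (hg.2 x))⟩,
        fun g hg => ⟨hg.1, fun x => (le_max_right _ _).trans ((h x).trans (hg.2 x))⟩⟩)
    (fun f => ⟨f, f.2, fun _ => le_rfl⟩)
    (fun f => hcomp.inter_right (hclosed f))
    (fun f => hcomp.isClosed.inter (hclosed f))
  rw [Set.mem_iInter] at hg
  exact ⟨g, (hg (Classical.arbitrary H)).1, fun f hf => (hg ⟨f, hf⟩).2⟩

/-- The pointwise supremum of a nonempty sup-norm compact upwards directed set `H` of bounded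
continuous functions on a nonempty topological space with a finite Borel measure of full
support is itself an element of `H` (in particular bounded and continuous). -/
theorem stmt3 {X : Type*} [TopologicalSpace X] [MeasurableSpace X] [BorelSpace X]
    [Nonempty X] (μ : Measure X) [IsFiniteMeasure μ] [μ.IsOpenPosMeasure]
    (H : Set (BoundedContinuousFunction X ℝ)) (hne : H.Nonempty) (hcomp : IsCompact H)
    (hdir : ∀ f₁ ∈ H, ∀ f₂ ∈ H, ∃ f ∈ H, ∀ x, max (f₁ x) (f₂ x) ≤ f x) :
    ∃ ub ∈ H, ∀ x, ub x = ⨆ f : H, (f : BoundedContinuousFunction X ℝ) x := by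
  obtain ⟨g, hgH, hg⟩ :=
    BoundedContinuousFunction.exists_isGreatest_of_isCompact hne hcomp hdir
  have : Nonempty H := hne.to_subtype
  refine ⟨g, hgH, fun x => le_antisymm ?_ (ciSup_le fun f => hg f f.2 x)⟩
  exact le_ciSup (f := fun f : H => (f : BoundedContinuousFunction X ℝ) x)
    ⟨g x, Set.forall_mem_range.2 fun f => hg f f.2 x⟩ ⟨g, hgH⟩
end

section
/- Let X be a nonempty topological space equipped with a finite Borel measure μ with full support, let H be a nonempty compact (in supremum norm) upwards directed subset of the bounded continuous real-valued functions on X, and let u : ℝ → ℝ be strictly increasing and continuous. Then the pointwise supremum ub(x) := sup_{f ∈ H} f(x) is the unique maximizer over h ∈ H of the reference-free functional h ↦ ∫_X u(h(x)) dμ(x); that is, the reference function f̂ can be removed from the objective without changing the maximizer. -/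
open MeasureTheory

open BoundedContinuousFunction in
/-- A nonempty upwards directed compact set of bounded continuous functions has a pointwise
greatest element. -/
theorem BoundedContinuousFunction.exists_pointwise_greatest_of_isCompact_of_directed
    {X : Type*} [TopologicalSpace X] {H : Set (X →ᵇ ℝ)} (hne : H.Nonempty) (hcomp : IsCompact H)
    (hdir : ∀ f₁ ∈ H, ∀ f₂ ∈ H, ∃ f ∈ H, ∀ x, max (f₁ x) (f₂ x) ≤ f x) :
    ∃ g ∈ H, ∀ f ∈ H, ∀ x, f x ≤ g x := by
  have : Nonempty H := hne.to_subtype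
  have hclosed (f : H) : IsClosed {g : X →ᵇ ℝ | ∀ x, (f : X →ᵇ ℝ) x ≤ g x} := by
    simp only [Set.ofPred_forall]
    exact isClosed_iInter fun x ↦ isClosed_le continuous_const (continuous_eval_const x)
  obtain ⟨g, hg⟩ := IsCompact.nonempty_iInter_of_directed_nonempty_isCompact_isClosed
    (fun f : H ↦ H ∩ {g : X →ᵇ ℝ | ∀ x, (f : X →ᵇ ℝ) x ≤ g x})
    (by
      rintro ⟨f₁, h₁⟩ ⟨f₂, h₂⟩
      obtain ⟨f, hf, hmax⟩ := hdir f₁ h₁ f₂ h₂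
      exact ⟨⟨f, hf⟩,
        fun g hg ↦ ⟨hg.1, fun x ↦ (le_max_left _ _).trans ((hmax x).trans (hg.2 x))⟩,
        fun g hg ↦ ⟨hg.1, fun x ↦ (le_max_right _ _).trans ((hmax x).trans (hg.2 x))⟩⟩)
    (fun f ↦ ⟨f, f.2, fun _ ↦ le_rfl⟩)
    (fun f ↦ hcomp.inter_right (hclosed f))
    (fun f ↦ hcomp.isClosed.inter (hclosed f))
  rw [Set.mem_iInter] at hg
  exact ⟨g, (hg (Classical.arbitrary H)).1, fun f hf ↦ (hg ⟨f, hf⟩).2⟩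

/-- A continuous monotone function of a bounded continuous function is integrable with respect to
a finite measure. -/
theorem BoundedContinuousFunction.integrable_monotone_comp {X : Type*} [TopologicalSpace X]
    [MeasurableSpace X] [BorelSpace X] (μ : Measure X) [IsFiniteMeasure μ] {u : ℝ → ℝ}
    (hu : Monotone u) (hucont : Continuous u) (h : BoundedContinuousFunction X ℝ) :
    Integrable (fun x ↦ u (h x)) μ := by
  refine Integrable.of_bound (hucont.comp h.continuous).measurable.aestronglyMeasurable
    (max |u (-‖h‖)| |u ‖h‖|) (.of_forall fun x ↦ ?_)
  have hx := abs_le.1 (h.norm_coe_le_norm x)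
  exact abs_le_max_abs_abs (hu hx.1) (hu hx.2)

/-- Reference-free version: the pointwise supremum `ub` of a nonempty sup-norm compact upwards
directed set `H` is the unique maximizer over `H` of `h ↦ ∫ u (h x) dμ` for every strictly
increasing continuous `u`; the reference function `f̂` can be removed from the objective. -/
theorem stmt4 {X : Type*} [TopologicalSpace X] [MeasurableSpace X] [BorelSpace X]
    [Nonempty X] (μ : Measure X) [IsFiniteMeasure μ] [μ.IsOpenPosMeasure]
    (H : Set (BoundedContinuousFunction X ℝ)) (hne : H.Nonempty) (hcomp : IsCompact H)
    (hdir : ∀ f₁ ∈ H, ∀ f₂ ∈ H, ∃ f ∈ H, ∀ x, max (f₁ x) (f₂ x) ≤ f x)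
    (u : ℝ → ℝ) (hu : StrictMono u) (hucont : Continuous u) :
    ∃ ub ∈ H,
      (∀ x, ub x = ⨆ f : H, (f : BoundedContinuousFunction X ℝ) x) ∧
      (∀ h ∈ H, ∫ x, u (h x) ∂μ ≤ ∫ x, u (ub x) ∂μ) ∧
      (∀ h ∈ H, (∫ x, u (h x) ∂μ) = (∫ x, u (ub x) ∂μ) → h = ub) := by
  obtain ⟨ub, hub, hge⟩ :=
    BoundedContinuousFunction.exists_pointwise_greatest_of_isCompact_of_directed hne hcomp hdir
  have hint := BoundedContinuousFunction.integrable_monotone_comp μ hu.monotone hucont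
  refine ⟨ub, hub, fun x ↦ ?_, fun h hh ↦ ?_, fun h hh heq ↦ ?_⟩
  · have hgr : IsGreatest (Set.range fun f : H ↦ (f : BoundedContinuousFunction X ℝ) x) (ub x) :=
      ⟨⟨⟨ub, hub⟩, rfl⟩, by rintro _ ⟨f, rfl⟩; exact hge f f.2 x⟩
    exact hgr.csSup_eq.symm
  · exact integral_mono (hint h) (hint ub) fun x ↦ hu.monotone (hge h hh x)
  · have hae := (integral_eq_iff_of_ae_le (hint h) (hint ub)
      (.of_forall fun x ↦ hu.monotone (hge h hh x))).1 heq
    have hfun := ((hucont.comp h.continuous).ae_eq_iff_eq μ (hucont.comp ub.continuous)).1 hae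
    ext x
    exact hu.injective (congrFun hfun x)
end

section
/- Let X be a nonempty topological space equipped with a finite Borel measure μ with full support, let H be a nonempty subset of the bounded continuous real-valued functions on X, compact with respect to the supremum norm and downwards directed, let f̂ ∈ H, and let u : ℝ → ℝ be strictly increasing and continuous. Then the pointwise infimum lb(x) := inf_{f ∈ H} f(x) belongs to H and is the unique minimizer over h ∈ H of the functional h ↦ ∫_X u(h(x) − f̂(x)) dμ(x). -/
open MeasureTheory

/-- A nonempty compact downwards directed set has a least element. -/
theorem IsCompact.exists_isLeast_of_directedOn {α : Type*} [TopologicalSpace α] [Preorder α]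
    [ClosedIicTopology α] {s : Set α} (hs : IsCompact s) (hne : s.Nonempty)
    (hdir : DirectedOn (· ≥ ·) s) : ∃ a, IsLeast s a := by
  have := hne.to_subtype
  have : IsCodirectedOrder s := ⟨fun a b => by
    obtain ⟨c, hc, hca, hcb⟩ := hdir a a.2 b b.2
    exact ⟨⟨c, hc⟩, hca, hcb⟩⟩
  obtain ⟨a, has, ha⟩ := hs.inter_iInter_nonempty (fun i : s => Set.Iic (i : α))
    (fun _ => isClosed_Iic) fun t => by
      obtain ⟨m, hm⟩ := t.finite_toSet.bddBelow
      exact ⟨m, m.2, Set.mem_iInter₂.2 fun i hi => hm hi⟩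
  exact ⟨a, has, fun b hb => Set.mem_iInter.1 ha ⟨b, hb⟩⟩

/-- A continuous monotone function of a bounded continuous function is integrable with respect to
a finite measure. -/
theorem BoundedContinuousFunction.integrable_comp_of_monotone {X : Type*} [TopologicalSpace X]
    [MeasurableSpace X] [OpensMeasurableSpace X] (μ : Measure X) [IsFiniteMeasure μ]
    (g : BoundedContinuousFunction X ℝ) {u : ℝ → ℝ} (hu : Monotone u) (hucont : Continuous u) :
    Integrable (fun x => u (g x)) μ := by
  refine Integrable.of_bound (hucont.comp g.continuous).aestronglyMeasurable
    (max |u (-‖g‖)| |u ‖g‖|) (Filter.Eventually.of_forall fun x => ?_)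
  have hx := abs_le.1 (g.norm_coe_le_norm x)
  exact abs_le_max_abs_abs (hu hx.1) (hu hx.2)

/-- Downwards directed version: the pointwise infimum `lb` of a nonempty sup-norm compact
downwards directed set `H` belongs to `H` and is the unique minimizer over `H` of
`h ↦ ∫ u (h x - f̂ x) dμ` for every strictly increasing continuous `u`. -/
theorem stmt5 {X : Type*} [TopologicalSpace X] [MeasurableSpace X] [BorelSpace X]
    [Nonempty X] (μ : Measure X) [IsFiniteMeasure μ] [μ.IsOpenPosMeasure]
    (H : Set (BoundedContinuousFunction X ℝ)) (hne : H.Nonempty) (hcomp : IsCompact H)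
    (hdir : ∀ f₁ ∈ H, ∀ f₂ ∈ H, ∃ f ∈ H, ∀ x, f x ≤ min (f₁ x) (f₂ x))
    (fhat : BoundedContinuousFunction X ℝ) (hfhat : fhat ∈ H)
    (u : ℝ → ℝ) (hu : StrictMono u) (hucont : Continuous u) :
    ∃ lb ∈ H,
      (∀ x, lb x = ⨅ f : H, (f : BoundedContinuousFunction X ℝ) x) ∧
      (∀ h ∈ H, ∫ x, u (lb x - fhat x) ∂μ ≤ ∫ x, u (h x - fhat x) ∂μ) ∧
      (∀ h ∈ H, (∫ x, u (h x - fhat x) ∂μ) = (∫ x, u (lb x - fhat x) ∂μ) → h = lb) := by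
  obtain ⟨lb, hlb, hle⟩ := hcomp.exists_isLeast_of_directedOn hne fun f₁ h₁ f₂ h₂ => by
    obtain ⟨f, hf, hmin⟩ := hdir f₁ h₁ f₂ h₂
    exact ⟨f, hf, fun x => (hmin x).trans (min_le_left _ _),
      fun x => (hmin x).trans (min_le_right _ _)⟩
  have hint (h : BoundedContinuousFunction X ℝ) : Integrable (fun x => u (h x - fhat x)) μ :=
    (h - fhat).integrable_comp_of_monotone μ hu.monotone hucont
  have hmono (h) (hh : h ∈ H) (x : X) : u (lb x - fhat x) ≤ u (h x - fhat x) :=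
    hu.monotone (sub_le_sub_right (hle hh x) _)
  refine ⟨lb, hlb, fun x => ?_, fun h hh => integral_mono (hint lb) (hint h) (hmono h hh),
    fun h hh heq => ?_⟩
  · have hleast : IsLeast (Set.range fun f : H => (f : BoundedContinuousFunction X ℝ) x) (lb x) :=
      ⟨⟨⟨lb, hlb⟩, rfl⟩, Set.forall_mem_range.2 fun f => hle f.2 x⟩
    exact hleast.csInf_eq.symm
  · have hae := (integral_eq_iff_of_ae_le (hint lb) (hint h)
      (Filter.Eventually.of_forall (hmono h hh))).1 heq.symm
    have hfun := (Continuous.ae_eq_iff_eq μ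
      (hucont.comp (lb - fhat).continuous) (hucont.comp (h - fhat).continuous)).1 hae
    ext x
    exact (sub_left_injective (hu.injective (congrFun hfun x))).symm
end

section
/- Let K be a symmetric positive semidefinite n×n real matrix and let D be a diagonal n×n real matrix with strictly positive diagonal entries. Then K + D is positive definite (hence invertible), and for every index i, the posterior variance at the i-th training point satisfies K_{ii} − (K e_i)ᵀ (K + D)⁻¹ (K e_i) ≤ D_{ii}, where e_i denotes the i-th standard basis vector; equivalently, (K − K (K + D)⁻¹ K)_{ii} ≤ D_{ii}. -/
open Matrix

namespace Matrix

/-- The parallel sum of two matrices is symmetric in its arguments. -/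
theorem sub_mul_inv_add_mul_comm {n R : Type*} [Fintype n] [DecidableEq n] [CommRing R]
    {A B : Matrix n n R} (h : IsUnit (A + B)) :
    A - A * (A + B)⁻¹ * A = B - B * (A + B)⁻¹ * B := by
  have hdet := (isUnit_iff_isUnit_det _).mp h
  have hA : A = (A + B) - B := (add_sub_cancel_right A B).symm
  generalize A + B = S at *
  subst hA
  simp only [sub_mul, mul_sub, mul_nonsing_inv _ hdet, one_mul, Matrix.mul_assoc,
    nonsing_inv_mul _ hdet, mul_one]
  abel

theorem PosSemidef.sub_mul_inv_add_mul_apply_le {n : Type*} [Fintype n] [DecidableEq n]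
    {A B : Matrix n n ℝ} (hA : A.PosSemidef) (hB : B.PosDef) (i : n) :
    (A - A * (A + B)⁻¹ * A) i i ≤ B i i := by
  have hS : (A + B).PosDef := PosDef.posSemidef_add hA hB
  have hnonneg := (hS.inv.posSemidef.mul_mul_conjTranspose_same B).diag_nonneg (i := i)
  rw [hB.isHermitian.eq] at hnonneg
  rw [sub_mul_inv_add_mul_comm hS.isUnit, sub_apply]
  exact sub_le_self _ hnonneg

theorem IsSymm.mulVec_single_dotProduct_mulVec {n R : Type*} [Fintype n] [DecidableEq n]
    [CommSemiring R] {A : Matrix n n R} (hA : A.IsSymm) (M : Matrix n n R) (i : n) :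
    A *ᵥ Pi.single i 1 ⬝ᵥ M *ᵥ (A *ᵥ Pi.single i 1) = (A * M * A) i i := by
  nth_rewrite 1 [← hA.eq]
  rw [mulVec_transpose, ← dotProduct_mulVec, single_one_dotProduct, mulVec_mulVec, mulVec_mulVec,
    mulVec_single_one, col_apply, Matrix.mul_assoc]

end Matrix

/-- GP posterior model uncertainty at training points is bounded by the data noise:
if `K` is symmetric PSD and `D = diagonal d` with `d i > 0`, then `K + D` is positive
definite (hence invertible) and `(K - K (K + D)⁻¹ K)ᵢᵢ ≤ Dᵢᵢ`, i.e.
`Kᵢᵢ - (K eᵢ)ᵀ (K + D)⁻¹ (K eᵢ) ≤ Dᵢᵢ`. -/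
theorem stmt9 {n : ℕ} (K : Matrix (Fin n) (Fin n) ℝ) (hK : K.PosSemidef)
    (d : Fin n → ℝ) (hd : ∀ i, 0 < d i) :
    (K + Matrix.diagonal d).PosDef ∧
    IsUnit (K + Matrix.diagonal d) ∧
    (∀ i, K i i -
        (K.mulVec (Pi.single i 1)) ⬝ᵥ ((K + Matrix.diagonal d)⁻¹.mulVec
          (K.mulVec (Pi.single i 1))) ≤ (Matrix.diagonal d) i i) ∧
    (∀ i, (K - K * (K + Matrix.diagonal d)⁻¹ * K) i i ≤ (Matrix.diagonal d) i i) := by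
  have hD : (Matrix.diagonal d).PosDef := PosDef.diagonal hd
  have hS : (K + Matrix.diagonal d).PosDef := PosDef.posSemidef_add hK hD
  have hle := hK.sub_mul_inv_add_mul_apply_le hD
  refine ⟨hS, hS.isUnit, fun i => ?_, hle⟩
  have hsymm : K.IsSymm := isHermitian_iff_isSymm.mp hK.isHermitian
  rw [hsymm.mulVec_single_dotProduct_mulVec, ← Matrix.sub_apply]
  exact hle i
end

section
/- Let P be a symmetric positive definite n×n real matrix, Q an n-dimensional real column vector, and S a real number such that the Schur complement s := S − Qᵀ P⁻¹ Q is strictly positive. Let B = [[P, Q], [Qᵀ, S]] be the corresponding (n+1)×(n+1) block matrix. Then for every real number k, every n-dimensional real vector v, and every real number w, one has k − (v, w)ᵀ B⁻¹ (v, w) ≤ k − vᵀ P⁻¹ v; that is, the Gaussian process posterior variance at any test point does not increase when an additional training point is added. -/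
open Matrix

/-- Explicit solution of a bordered linear system, by elimination of the leading block. -/
theorem fromBlocks_mulVec_schur_solution {m : Type*} [Fintype m] [DecidableEq m]
    (P : Matrix m m ℝ) (hP : IsUnit P.det) (q v : m → ℝ) (S w c : ℝ)
    (hc : c * (S - q ⬝ᵥ P⁻¹ *ᵥ q) = w - q ⬝ᵥ P⁻¹ *ᵥ v) :
    Matrix.fromBlocks P (Matrix.of fun i (_ : Unit) => q i)
      (Matrix.of fun (_ : Unit) j => q j) (Matrix.of fun (_ : Unit) (_ : Unit) => S) *ᵥ
      Sum.elim (P⁻¹ *ᵥ v - c • P⁻¹ *ᵥ q) (fun _ => c) = Sum.elim v fun _ => w := by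
  rw [fromBlocks_mulVec, Sum.elim_comp_inl, Sum.elim_comp_inr]
  congr 1
  · rw [mulVec_sub, mulVec_smul, mulVec_mulVec, mulVec_mulVec, mul_nonsing_inv _ hP,
      one_mulVec, one_mulVec]
    ext i
    simp [mulVec, dotProduct, mul_comm]
  · ext i
    have h : q ⬝ᵥ (P⁻¹ *ᵥ v - c • P⁻¹ *ᵥ q) + S * c = w := by
      rw [dotProduct_sub, dotProduct_smul, smul_eq_mul]
      linear_combination hc
    simpa [mulVec, dotProduct] using h

/-- GP posterior variance does not increase when a training point is added: if `P` is
symmetric positive definite and the Schur complement `s := S - qᵀ P⁻¹ q` is positive, then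
for the block matrix `B = [[P, q], [qᵀ, S]]` and all `k`, `v`, `w`:
`k - (v,w)ᵀ B⁻¹ (v,w) ≤ k - vᵀ P⁻¹ v`. -/
theorem stmt11 {n : ℕ} (P : Matrix (Fin n) (Fin n) ℝ) (hP : P.PosDef)
    (q : Fin n → ℝ) (S : ℝ)
    (s : ℝ) (hs : s = S - q ⬝ᵥ P⁻¹.mulVec q) (hs0 : 0 < s)
    (B : Matrix (Fin n ⊕ Unit) (Fin n ⊕ Unit) ℝ)
    (hB : B = Matrix.fromBlocks P (Matrix.of fun i (_ : Unit) => q i)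
      (Matrix.of fun (_ : Unit) j => q j) (Matrix.of fun (_ : Unit) (_ : Unit) => S)) :
    ∀ (k : ℝ) (v : Fin n → ℝ) (w : ℝ),
      k - (Sum.elim v fun _ => w) ⬝ᵥ B⁻¹.mulVec (Sum.elim v fun _ => w) ≤
        k - v ⬝ᵥ P⁻¹.mulVec v := by
  intro k v w
  subst hB hs
  have hdet : IsUnit P.det := hP.det_pos.ne'.isUnit
  have hsol (x : Fin n → ℝ) (y : ℝ) := fromBlocks_mulVec_schur_solution P hdet q x S y
    ((y - q ⬝ᵥ P⁻¹ *ᵥ x) / (S - q ⬝ᵥ P⁻¹ *ᵥ q)) (div_mul_cancel₀ _ hs0.ne')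
  set B := Matrix.fromBlocks P (Matrix.of fun i (_ : Unit) => q i)
    (Matrix.of fun (_ : Unit) j => q j) (Matrix.of fun (_ : Unit) (_ : Unit) => S)
  have hB : IsUnit B := mulVec_surjective_iff_isUnit.mp fun z =>
    ⟨_, (hsol (z ∘ Sum.inl) (z (Sum.inr ()))).trans (Sum.elim_comp_inl_inr z)⟩
  have hsymm : v ⬝ᵥ P⁻¹ *ᵥ q = q ⬝ᵥ P⁻¹ *ᵥ v := by
    have hT : P⁻¹ᵀ = P⁻¹ := by simpa using hP.isHermitian.inv.eq
    rw [dotProduct_mulVec, ← mulVec_transpose, hT, dotProduct_comm]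
  have hvw := hsol v w
  set c := (w - q ⬝ᵥ P⁻¹ *ᵥ v) / (S - q ⬝ᵥ P⁻¹ *ᵥ q)
  have hcs : c * (S - q ⬝ᵥ P⁻¹ *ᵥ q) = w - q ⬝ᵥ P⁻¹ *ᵥ v := div_mul_cancel₀ _ hs0.ne'
  have hinv : B⁻¹ *ᵥ (Sum.elim v fun _ => w) =
      Sum.elim (P⁻¹ *ᵥ v - c • P⁻¹ *ᵥ q) (fun _ => c) := by
    rw [← hvw, mulVec_mulVec, nonsing_inv_mul _ ((isUnit_iff_isUnit_det _).mp hB), one_mulVec]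
  have hone : (fun _ : Unit => w) ⬝ᵥ (fun _ => c) = w * c := by simp [dotProduct]
  have hquad : (Sum.elim v fun _ => w) ⬝ᵥ B⁻¹ *ᵥ (Sum.elim v fun _ => w) =
      v ⬝ᵥ P⁻¹ *ᵥ v + c ^ 2 * (S - q ⬝ᵥ P⁻¹ *ᵥ q) := by
    rw [hinv, sumElim_dotProduct_sumElim, hone, dotProduct_sub, dotProduct_smul, smul_eq_mul,
      hsymm]
    linear_combination -c * hcs
  rw [hquad]
  have := mul_nonneg (sq_nonneg c) hs0.le
  linarith
end
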